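/- Occupation bound for FTRL in strongly monotone games: under the FTRL iteration Y_{n+1} = Y_n + η ĝ_n, X_n = Q(Y_n) with constant step-size η > 0, ĝ_n = V(X_n) + U_n with E[U_n | F_n] = 0 and E[‖U_n‖*² | F_n] ≤ σ², in a γ-strongly monotone game with equilibrium x* satisfying ⟨V(x*), x − x*⟩ ≤ 0 for all x, with ‖V(x)‖* ≤ L and h K-strongly convex, and with r_σ² = η(σ² + L²)/(γK), one has for every n ≥ 1 and every r > 0: (1/n) · E[ Σ_{k=0}^{n−1} 1{ ‖X_k − x*‖ > r } ] ≤ F(x*, Y_0)/(γ η n r²) + r_σ²/r². -/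

import Mathlib

open MeasureTheory Filter
open scoped ENNReal

section MirrorMap

variable {E : Type*} [NormedAddCommGroup E] [NormedSpace ℝ E] {X : Set E} {h : E → ℝ} {K : ℝ}

/-- A linear functional minus a strongly convex function decays quadratically away from its
maximizer. -/
theorem StrongConvexOn.linear_sub_add_le (hh : StrongConvexOn X K h) {y : E →L[ℝ] ℝ} {q : E}
    (hq : q ∈ X) (hmax : IsMaxOn (fun x => y x - h x) X q) {x : E} (hx : x ∈ X) :
    y x - h x + K / 2 * ‖x - q‖ ^ 2 ≤ y q - h q := by
  have key : ∀ t ∈ Set.Ioc (0 : ℝ) 1,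
      y x - h x + (1 - t) * (K / 2 * ‖x - q‖ ^ 2) ≤ y q - h q := by
    intro t ht
    have ht' : (0 : ℝ) ≤ 1 - t := by linarith [ht.2]
    have hconv := hh.2 hx hq ht.1.le ht' (by ring)
    have hle : y (t • x + (1 - t) • q) - h (t • x + (1 - t) • q) ≤ y q - h q :=
      hmax (hh.1 hx hq ht.1.le ht' (by ring))
    simp only [map_add, map_smul, smul_eq_mul] at hconv hle
    refine le_of_mul_le_mul_left ?_ ht.1
    linarith
  have hlim : Tendsto (fun t : ℝ => y x - h x + (1 - t) * (K / 2 * ‖x - q‖ ^ 2))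
      (nhdsWithin 0 (Set.Ioi 0)) (nhds (y x - h x + (1 - 0) * (K / 2 * ‖x - q‖ ^ 2))) :=
    tendsto_nhdsWithin_of_tendsto_nhds (Continuous.tendsto (by fun_prop) 0)
  have := le_of_tendsto hlim
    (by filter_upwards [Ioc_mem_nhdsGT zero_lt_one] with t ht using key t ht)
  linarith

variable {Q : (E →L[ℝ] ℝ) → E}

/-- The mirror map of a `K`-strongly convex regularizer is `K⁻¹`-Lipschitz. -/
theorem StrongConvexOn.norm_mirrorMap_sub_le (hh : StrongConvexOn X K h) (hK : 0 < K)
    (hQ : ∀ y, Q y ∈ X) (hmax : ∀ y, IsMaxOn (fun x => y x - h x) X (Q y))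
    (y y' : E →L[ℝ] ℝ) : ‖Q y - Q y'‖ ≤ K⁻¹ * ‖y - y'‖ := by
  have h1 := hh.linear_sub_add_le (hQ y) (hmax y) (hQ y')
  have h2 := hh.linear_sub_add_le (hQ y') (hmax y') (hQ y)
  rw [norm_sub_rev] at h1
  have h3 : (y - y') (Q y - Q y') ≤ ‖y - y'‖ * ‖Q y - Q y'‖ :=
    (le_abs_self _).trans ((y - y').le_opNorm _)
  simp only [sub_apply, map_sub] at h3
  rw [inv_mul_eq_div, le_div_iff₀ hK]
  rcases (norm_nonneg (Q y - Q y')).eq_or_lt with h0 | h0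
  · rw [← h0]; simp
  · refine le_of_mul_le_mul_right ?_ h0
    nlinarith

/-- The conjugate of a `K`-strongly convex regularizer is `K⁻¹`-smooth. -/
theorem StrongConvexOn.conjugate_add_le (hh : StrongConvexOn X K h) (hK : 0 < K)
    (hQ : ∀ y, Q y ∈ X) (hmax : ∀ y, IsMaxOn (fun x => y x - h x) X (Q y))
    (y v : E →L[ℝ] ℝ) :
    (y + v) (Q (y + v)) - h (Q (y + v)) ≤ y (Q y) - h (Q y) + v (Q y) + ‖v‖ ^ 2 / (2 * K) := by
  have h1 := hh.linear_sub_add_le (hQ y) (hmax y) (hQ (y + v))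
  have h3 : v (Q (y + v) - Q y) ≤ ‖v‖ * ‖Q (y + v) - Q y‖ :=
    (le_abs_self _).trans (v.le_opNorm _)
  have h4 : ‖v‖ * ‖Q (y + v) - Q y‖ ≤ K / 2 * ‖Q (y + v) - Q y‖ ^ 2 + ‖v‖ ^ 2 / (2 * K) := by
    have : K / 2 * ‖Q (y + v) - Q y‖ ^ 2 + ‖v‖ ^ 2 / (2 * K) - ‖v‖ * ‖Q (y + v) - Q y‖
        = (K * ‖Q (y + v) - Q y‖ - ‖v‖) ^ 2 / (2 * K) := by
      field_simp
      ring
    have : 0 ≤ (K * ‖Q (y + v) - Q y‖ - ‖v‖) ^ 2 / (2 * K) := by positivity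
    linarith
  simp only [add_apply, map_sub] at h3 ⊢
  linarith

end MirrorMap

section Equilibrium

variable {E : Type*} [NormedAddCommGroup E] [NormedSpace ℝ E] {X : Set E}
  {V : E → (E →L[ℝ] ℝ)} {γ : ℝ} {xstar : E}

theorem strongMonotone_apply_sub_equilibrium_le
    (hmono : ∀ x ∈ X, ∀ x' ∈ X, (V x' - V x) (x' - x) ≤ -γ * ‖x' - x‖ ^ 2)
    (hxstar : xstar ∈ X) (heq : ∀ x ∈ X, (V xstar) (x - xstar) ≤ 0) {x : E} (hx : x ∈ X) :
    V x (x - xstar) ≤ -γ * ‖x - xstar‖ ^ 2 := by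
  have h1 := hmono xstar hxstar x hx
  have h2 := heq x hx
  rw [sub_apply] at h1
  linarith

theorem strongMonotone_norm_sub_equilibrium_le (hγ : 0 < γ)
    (hmono : ∀ x ∈ X, ∀ x' ∈ X, (V x' - V x) (x' - x) ≤ -γ * ‖x' - x‖ ^ 2)
    (hxstar : xstar ∈ X) (heq : ∀ x ∈ X, (V xstar) (x - xstar) ≤ 0) {x : E} (hx : x ∈ X) :
    ‖x - xstar‖ ≤ ‖V x‖ / γ := by
  have h1 := strongMonotone_apply_sub_equilibrium_le hmono hxstar heq hx
  have h2 := (neg_abs_le _).trans' (neg_le_neg ((V x).le_opNorm (x - xstar)))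
  rw [le_div_iff₀ hγ]
  rcases (norm_nonneg (x - xstar)).eq_or_lt with h0 | h0
  · rw [← h0]; simp
  · refine le_of_mul_le_mul_right ?_ h0
    nlinarith

end Equilibrium

/-- A bounded `m`-measurable direction is uncorrelated with noise whose conditional mean given `m`
vanishes. -/
theorem integral_apply_eq_zero_of_condExp_eq_zero {E Ω : Type*} [NormedAddCommGroup E]
    [NormedSpace ℝ E] {m mΩ : MeasurableSpace Ω} {μ : Measure Ω} [IsFiniteMeasure μ] (hm : m ≤ mΩ)
    {f : Ω → E} {U : Ω → (E →L[ℝ] ℝ)} (hf : StronglyMeasurable[m] f) {c : ℝ}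
    (hc : ∀ ω, ‖f ω‖ ≤ c) (hU : Integrable U μ) (hmean : μ[U | m] =ᵐ[μ] 0) :
    ∫ ω, U ω (f ω) ∂μ = 0 := by
  have hpull := condExp_stronglyMeasurable_bilin_of_bound
    (ContinuousLinearMap.apply ℝ ℝ : E →L[ℝ] (E →L[ℝ] ℝ) →L[ℝ] ℝ) hm hf hU c (ae_of_all μ hc)
  simp only [ContinuousLinearMap.apply_apply] at hpull
  rw [← integral_condExp hm, integral_congr_ae hpull]
  refine integral_eq_zero_of_ae ?_
  filter_upwards [hmean] with ω hω
  simp [hω]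

theorem integrable_apply_of_bounded {E Ω : Type*} [NormedAddCommGroup E]
    [NormedSpace ℝ E] {mΩ : MeasurableSpace Ω} {μ : Measure Ω}
    {f : Ω → E} {U : Ω → (E →L[ℝ] ℝ)} (hf : AEStronglyMeasurable f μ) {c : ℝ}
    (hc : ∀ ω, ‖f ω‖ ≤ c) (hU : Integrable U μ) :
    Integrable (fun ω => U ω (f ω)) μ := by
  refine (hU.norm.mul_const c).mono' ?_ (ae_of_all μ fun ω => ?_)
  · exact (ContinuousLinearMap.apply ℝ ℝ : E →L[ℝ] (E →L[ℝ] ℝ) →L[ℝ] ℝ).aestronglyMeasurable_comp₂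
      hf hU.aestronglyMeasurable
  · exact ((U ω).le_opNorm _).trans (mul_le_mul_of_nonneg_left (hc ω) (norm_nonneg _))

/-- **occupation bound for FTRL in strongly monotone games.**
Under the FTRL iteration `Y (n+1) = Y n + η ĝ n`, `X n = Q (Y n)` with constant
step-size `η > 0`, `ĝ n = V (X n) + U n` with `E[U n | ℱ n] = 0` and
`E[‖U n‖*² | ℱ n] ≤ σ²`, in a `γ`-strongly monotone game with equilibrium `x*`
satisfying `⟨V x*, x - x*⟩ ≤ 0` on `X`, with `‖V x‖* ≤ L` and `h` `K`-strongly
convex, and with `r_σ² = η (σ² + L²) / (γ K)`, one has for every `n ≥ 1` and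
every `r > 0`:
`(1/n) E[Σ_{k < n} 1{‖X k - x*‖ > r}] ≤ F (x*, Y 0) / (γ η n r²) + r_σ² / r²`. -/
theorem ftrl_occupation_bound_strongly_monotone
    {E : Type*} [NormedAddCommGroup E] [NormedSpace ℝ E] [FiniteDimensional ℝ E]
    (X : Set E) (hXne : X.Nonempty) (hXcl : IsClosed X) (hXcv : Convex ℝ X)
    -- the regularizer and its mirror map / conjugate / Fenchel coupling
    (h : E → ℝ) (K : ℝ) (hK : 0 < K)
    (hcont : ContinuousOn h X)
    (hsc : ∀ x ∈ X, ∀ x' ∈ X, ∀ t : ℝ, t ∈ Set.Icc (0:ℝ) 1 →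
      h (t • x + (1 - t) • x') ≤
        t * h x + (1 - t) * h x' - K / 2 * (t * (1 - t)) * ‖x' - x‖ ^ 2)
    (Q : (E →L[ℝ] ℝ) → E)
    (hQmem : ∀ y, Q y ∈ X)
    (hQmax : ∀ y, ∀ x ∈ X, y x - h x ≤ y (Q y) - h (Q y))
    (hstar : (E →L[ℝ] ℝ) → ℝ)
    (hstar_eq : ∀ y, hstar y = y (Q y) - h (Q y))
    -- the strongly monotone game and its equilibrium
    (V : E → (E →L[ℝ] ℝ)) (hVcont : Continuous V)
    (γ : ℝ) (hγ : 0 < γ)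
    (hmono : ∀ x ∈ X, ∀ x' ∈ X, (V x' - V x) (x' - x) ≤ -γ * ‖x' - x‖ ^ 2)
    (L : ℝ) (hL : ∀ x ∈ X, ‖V x‖ ≤ L)
    (xstar : E) (hxstar : xstar ∈ X)
    (heq : ∀ x ∈ X, (V xstar) (x - xstar) ≤ 0)
    -- the stochastic process
    {Ω : Type*} {mΩ : MeasurableSpace Ω} {μ : Measure Ω} [IsProbabilityMeasure μ]
    (ℱ : Filtration ℕ mΩ)
    (η : ℝ) (hη : 0 < η)
    (y₀ : E →L[ℝ] ℝ)
    (Y U : ℕ → Ω → (E →L[ℝ] ℝ))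
    (hY0 : ∀ ω, Y 0 ω = y₀)
    (hrec : ∀ n ω, Y (n + 1) ω = Y n ω + η • (V (Q (Y n ω)) + U n ω))
    (hYad : ∀ n, StronglyMeasurable[ℱ n] (Y n))
    (hUad : ∀ n, StronglyMeasurable[ℱ (n + 1)] (U n))
    (hUint : ∀ n, Integrable (U n) μ)
    (hU2int : ∀ n, Integrable (fun ω => ‖U n ω‖ ^ 2) μ)
    (hUmean : ∀ n, μ[U n | ℱ n] =ᵐ[μ] 0)
    (σ : ℝ)
    (hUvar : ∀ n, μ[fun ω => ‖U n ω‖ ^ 2 | ℱ n] ≤ᵐ[μ] fun _ : Ω => σ ^ 2)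
    (n : ℕ) (hn : 1 ≤ n) (r : ℝ) (hr : 0 < r) :
    (∫⁻ ω, ∑ k ∈ Finset.range n,
        Set.indicator {ω' : Ω | r < ‖Q (Y k ω') - xstar‖} (fun _ => (1 : ℝ≥0∞)) ω ∂μ)
        / (n : ℝ≥0∞) ≤
      ENNReal.ofReal ((h xstar + hstar y₀ - y₀ xstar) / (γ * η * n * r ^ 2)
        + (η * (σ ^ 2 + L ^ 2) / (γ * K)) / r ^ 2) := by
  have hh : StrongConvexOn X K h := by
    refine ⟨hXcv, fun x hx x' hx' a b ha hb hab => ?_⟩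
    obtain rfl : b = 1 - a := by linarith
    have := hsc x hx x' hx' a ⟨ha, by linarith⟩
    rw [norm_sub_rev] at this
    simp only [smul_eq_mul]
    linarith
  have hmax : ∀ y : E →L[ℝ] ℝ, IsMaxOn (fun x => y x - h x) X (Q y) := fun y x hx => hQmax y x hx
  have hQcont : Continuous Q := by
    refine (LipschitzWith.of_dist_le_mul (K := ⟨K⁻¹, (inv_pos.2 hK).le⟩) fun y y' => ?_).continuous
    rw [dist_eq_norm, dist_eq_norm]
    exact hh.norm_mirrorMap_sub_le hK hQmem hmax y y'
  have hbound : ∀ y, ‖Q y - xstar‖ ≤ L / γ := fun y =>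
    (strongMonotone_norm_sub_equilibrium_le hγ hmono hxstar heq (hQmem y)).trans
      (div_le_div_of_nonneg_right (hL _ (hQmem y)) hγ.le)
  have hmeas : ∀ k, StronglyMeasurable[ℱ k] fun ω => Q (Y k ω) - xstar := fun k =>
    (hQcont.comp_stronglyMeasurable (hYad k)).sub stronglyMeasurable_const
  -- the noise contribution to the one-step decrease of the Fenchel coupling
  set ξ : ℕ → Ω → ℝ := fun k ω =>
    η * U k ω (Q (Y k ω) - xstar) + η ^ 2 / K * (L ^ 2 + ‖U k ω‖ ^ 2) with hξ
  have hstep : ∀ k ω, hstar (Y (k + 1) ω) - Y (k + 1) ω xstar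
      ≤ hstar (Y k ω) - Y k ω xstar - γ * η * ‖Q (Y k ω) - xstar‖ ^ 2 + ξ k ω := by
    intro k ω
    have h1 := hh.conjugate_add_le hK hQmem hmax (Y k ω) (η • (V (Q (Y k ω)) + U k ω))
    rw [← hrec, ← hstar_eq, ← hstar_eq] at h1
    have h2 : Y (k + 1) ω xstar = Y k ω xstar + η * (V (Q (Y k ω)) xstar + U k ω xstar) := by
      rw [hrec]; simp [mul_add]
    have h3 := mul_le_mul_of_nonneg_left
      (strongMonotone_apply_sub_equilibrium_le hmono hxstar heq (hQmem (Y k ω))) hη.le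
    have h4 : ‖η • (V (Q (Y k ω)) + U k ω)‖ ^ 2 / (2 * K)
        ≤ η ^ 2 / K * (L ^ 2 + ‖U k ω‖ ^ 2) := by
      have h5 : ‖V (Q (Y k ω)) + U k ω‖ ≤ L + ‖U k ω‖ :=
        (norm_add_le _ _).trans (by gcongr; exact hL _ (hQmem _))
      have h6 : ‖V (Q (Y k ω)) + U k ω‖ ^ 2 ≤ 2 * (L ^ 2 + ‖U k ω‖ ^ 2) :=
        (pow_le_pow_left₀ (norm_nonneg _) h5 2).trans (by nlinarith [sq_nonneg (L - ‖U k ω‖)])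
      rw [norm_smul, mul_pow, Real.norm_eq_abs, sq_abs]
      calc η ^ 2 * ‖V (Q (Y k ω)) + U k ω‖ ^ 2 / (2 * K)
          ≤ η ^ 2 * (2 * (L ^ 2 + ‖U k ω‖ ^ 2)) / (2 * K) := by gcongr
        _ = η ^ 2 / K * (L ^ 2 + ‖U k ω‖ ^ 2) := by field_simp
    simp only [smul_apply, add_apply, smul_eq_mul, map_sub] at h1 h3
    simp only [hξ, map_sub]
    linarith
  have htel : ∀ m ω, γ * η * ∑ k ∈ Finset.range m, ‖Q (Y k ω) - xstar‖ ^ 2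
      ≤ hstar y₀ - y₀ xstar - (hstar (Y m ω) - Y m ω xstar) + ∑ k ∈ Finset.range m, ξ k ω := by
    intro m ω
    induction m with
    | zero => simp [hY0]
    | succ m ih =>
      rw [Finset.sum_range_succ, Finset.sum_range_succ, mul_add]
      linarith [hstep m ω]
  have hsum : ∀ ω, γ * η * ∑ k ∈ Finset.range n, ‖Q (Y k ω) - xstar‖ ^ 2
      ≤ h xstar + hstar y₀ - y₀ xstar + ∑ k ∈ Finset.range n, ξ k ω := by
    intro ω
    have := hQmax (Y n ω) xstar hxstar
    rw [← hstar_eq] at this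
    linarith [htel n ω]
  have hAint : ∀ k, Integrable (fun ω => U k ω (Q (Y k ω) - xstar)) μ := fun k =>
    integrable_apply_of_bounded ((hmeas k).mono (ℱ.le k)).aestronglyMeasurable
      (fun ω => hbound _) (hUint k)
  have hBint : ∀ k, Integrable (fun ω => L ^ 2 + ‖U k ω‖ ^ 2) μ := fun k =>
    (integrable_const _).add (hU2int k)
  have hξint : ∀ k, Integrable (ξ k) μ := fun k =>
    ((hAint k).const_mul _).add ((hBint k).const_mul _)
  have hξle : ∀ k, ∫ ω, ξ k ω ∂μ ≤ η ^ 2 / K * (σ ^ 2 + L ^ 2) := by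
    intro k
    have hvar : ∫ ω, ‖U k ω‖ ^ 2 ∂μ ≤ σ ^ 2 := by
      rw [← integral_condExp (ℱ.le k)]
      simpa using integral_mono_ae integrable_condExp (integrable_const (σ ^ 2)) (hUvar k)
    rw [integral_add ((hAint k).const_mul _) ((hBint k).const_mul _), integral_const_mul,
      integral_const_mul, integral_add (integrable_const _) (hU2int k),
      integral_apply_eq_zero_of_condExp_eq_zero (ℱ.le k) (hmeas k) (fun ω => hbound _) (hUint k)
        (hUmean k)]
    simp only [mul_zero, zero_add, integral_const, probReal_univ, one_smul]
    rw [add_comm (σ ^ 2)]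
    gcongr
  set G : Ω → ℝ := fun ω =>
    (h xstar + hstar y₀ - y₀ xstar + ∑ k ∈ Finset.range n, ξ k ω) / (γ * η * r ^ 2) with hG
  have hpos : 0 < γ * η * r ^ 2 := by positivity
  have hGint : Integrable G μ :=
    ((integrable_const _).add (integrable_finsetSum _ fun k _ => hξint k)).div_const _
  have hG0 : ∀ ω, 0 ≤ G ω := fun ω => div_nonneg ((hsum ω).trans' (by positivity)) hpos.le
  have hcount : ∀ ω, ∑ k ∈ Finset.range n,
      Set.indicator {ω' : Ω | r < ‖Q (Y k ω') - xstar‖} (fun _ => (1 : ℝ≥0∞)) ω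
        ≤ ENNReal.ofReal (G ω) := by
    intro ω
    calc _ ≤ ∑ k ∈ Finset.range n, ENNReal.ofReal (‖Q (Y k ω) - xstar‖ ^ 2 / r ^ 2) := by
          refine Finset.sum_le_sum fun k _ =>
            Set.indicator_apply_le' (fun hω => ?_) fun _ => zero_le
          rw [← ENNReal.ofReal_one]
          refine ENNReal.ofReal_le_ofReal ?_
          rw [one_le_div (by positivity)]
          exact pow_le_pow_left₀ hr.le (le_of_lt hω) 2
      _ = ENNReal.ofReal (∑ k ∈ Finset.range n, ‖Q (Y k ω) - xstar‖ ^ 2 / r ^ 2) :=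
          (ENNReal.ofReal_sum_of_nonneg fun k _ => by positivity).symm
      _ ≤ ENNReal.ofReal (G ω) := by
          refine ENNReal.ofReal_le_ofReal ?_
          rw [← Finset.sum_div, hG, div_le_div_iff₀ (by positivity) hpos]
          nlinarith [mul_le_mul_of_nonneg_right (hsum ω) (sq_nonneg r)]
  have hGle : ∫ ω, G ω ∂μ ≤ ((h xstar + hstar y₀ - y₀ xstar) / (γ * η * n * r ^ 2)
      + (η * (σ ^ 2 + L ^ 2) / (γ * K)) / r ^ 2) * n := by
    have hn' : (0 : ℝ) < n := by exact_mod_cast hn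
    rw [integral_div, integral_add (integrable_const _) (integrable_finsetSum _ fun k _ => hξint k),
      integral_finsetSum _ fun k _ => hξint k]
    have hsum_le := Finset.sum_le_sum fun k (_ : k ∈ Finset.range n) => hξle k
    rw [Finset.sum_const, Finset.card_range, nsmul_eq_mul] at hsum_le
    simp only [integral_const, probReal_univ, one_smul]
    calc _ ≤ (h xstar + hstar y₀ - y₀ xstar + n * (η ^ 2 / K * (σ ^ 2 + L ^ 2)))
          / (γ * η * r ^ 2) := by gcongr
      _ = _ := by field_simp
  refine ENNReal.div_le_of_le_mul ?_
  calc _ ≤ ∫⁻ ω, ENNReal.ofReal (G ω) ∂μ := lintegral_mono hcount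
    _ = ENNReal.ofReal (∫ ω, G ω ∂μ) :=
        (ofReal_integral_eq_lintegral_ofReal hGint (ae_of_all μ hG0)).symm
    _ ≤ _ := by
        rw [← ENNReal.ofReal_natCast, ← ENNReal.ofReal_mul' (Nat.cast_nonneg n)]
        exact ENNReal.ofReal_le_ofReal hGle
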